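/- The word N = abacbabcabacbcacbabcabacabcbabcabacbcabcb over the alphabet {a,b,c} is square-free and has exactly two square-free extensions, namely cN and Na: inserting any letter at any position of N other than inserting c at the very beginning or a at the very end yields a word containing a square. -/

import Mathlib

/-- A word (a list of letters) is square-free if it contains no nonempty
factor of the form `x ++ x`. -/
def SquareFree {α : Type*} (w : List α) : Prop :=
  ∀ x : List α, x ≠ [] → ¬ (x ++ x) <:+: w

/-- The letter `a` of the 3-letter alphabet. -/
def a : Fin 3 := 0
/-- The letter `b` of the 3-letter alphabet. -/
def b : Fin 3 := 1
/-- The letter `c` of the 3-letter alphabet. -/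
def c : Fin 3 := 2

/-- The word `N = abacbabcabacbcacbabcabacabcbabcabacbcabcb`. -/
def N : List (Fin 3) :=
  [a, b, a, c, b, a, b, c, a, b, a, c, b, c, a, c, b, a, b, c, a, b, a, c,
   a, b, c, b, a, b, c, a, b, a, c, b, c, a, b, c, b]

/-- No square starts at the beginning of `l`. -/
def noSquareHere (l : List (Fin 3)) : Bool :=
  (List.range l.length).all fun p => !((l.take (p + 1)).isPrefixOf (l.drop (p + 1)))

/-- Boolean test for square-freeness. -/
def chk : List (Fin 3) → Bool
  | [] => true
  | h :: t => noSquareHere (h :: t) && chk t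

theorem noSquareHere_iff (l : List (Fin 3)) :
    noSquareHere l = true ↔ ∀ x : List (Fin 3), x ≠ [] → ¬ (x ++ x) <+: l := by
  constructor
  · rintro h x hx ⟨r, rfl⟩
    simp only [noSquareHere, List.all_eq_true, List.mem_range] at h
    have hl : 0 < x.length := List.length_pos_iff.mpr hx
    have h2 := h (x.length - 1) (by simp only [List.length_append]; omega)
    rw [Nat.sub_add_cancel hl] at h2
    rw [List.append_assoc, List.take_left, List.drop_left] at h2
    have h3 : x.isPrefixOf (x ++ r) = true := List.isPrefixOf_iff_prefix.mpr ⟨r, rfl⟩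
    simp [h3] at h2
  · intro h
    simp only [noSquareHere, List.all_eq_true, List.mem_range]
    intro p hp
    by_contra hc
    simp only [Bool.not_eq_true', Bool.not_eq_false, List.isPrefixOf_iff_prefix] at hc
    apply h (l.take (p + 1))
    · intro h0
      have := congrArg List.length h0
      simp at this
      simp [this] at hp
    · obtain ⟨r, hr⟩ := hc
      exact ⟨r, by rw [List.append_assoc, hr, List.take_append_drop]⟩

theorem chk_iff (l : List (Fin 3)) : chk l = true ↔ SquareFree l := by
  induction l with
  | nil => simp [chk, SquareFree]
  | cons h t ih =>
    rw [chk, Bool.and_eq_true, ih, noSquareHere_iff]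
    simp only [SquareFree, List.infix_cons_iff]
    grind

theorem chk_N : chk N = true := by decide +kernel

/-- A square of period `p` occurs at position `s` of `w`. -/
def squareAt (w : List (Fin 3)) (s p : ℕ) : Bool :=
  Nat.blt 0 p && Nat.ble (s + 2 * p) w.length &&
    ((w.drop s).take p).isPrefixOf ((w.drop s).drop p)

theorem not_squareFree_of_squareAt (w : List (Fin 3)) (s p : ℕ) (h : squareAt w s p = true) :
    ¬ SquareFree w := by
  simp only [squareAt, Bool.and_eq_true, Nat.blt_eq, Nat.ble_eq,
    List.isPrefixOf_iff_prefix] at h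
  obtain ⟨⟨h0, hl⟩, r, hr⟩ := h
  intro hs
  apply hs ((w.drop s).take p)
  · intro hn
    have := congrArg List.length hn
    simp at this
    omega
  · refine ⟨w.take s, r, ?_⟩
    rw [List.append_assoc, List.append_assoc, hr, List.take_append_drop, List.take_append_drop]

/-- For each insertion position and each letter, the position and period of a square
in the resulting word (`(0, 0)` for the two square-free extensions). -/
def squareTable : List (List (ℕ × ℕ)) :=
  [[(0, 1), (0, 2), (0, 0)],
   [(0, 1), (1, 1), (0, 3)],
   [(2, 1), (1, 1), (1, 12)],
   [(2, 1), (0, 2), (3, 1)],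
   [(4, 2), (4, 1), (3, 1)],
   [(5, 1), (4, 1), (4, 3)],
   [(5, 1), (6, 1), (1, 3)],
   [(4, 2), (6, 1), (7, 1)],
   [(8, 1), (8, 2), (7, 1)],
   [(8, 1), (9, 1), (8, 3)],
   [(10, 1), (9, 1), (5, 3)],
   [(10, 1), (8, 2), (11, 1)],
   [(2, 13), (12, 1), (11, 1)],
   [(13, 2), (12, 1), (13, 1)],
   [(14, 1), (11, 2), (13, 1)],
   [(14, 1), (13, 11), (15, 1)],
   [(13, 2), (16, 1), (15, 1)],
   [(17, 1), (16, 1), (16, 3)],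
   [(17, 1), (18, 1), (14, 3)],
   [(16, 2), (18, 1), (19, 1)],
   [(20, 1), (20, 2), (19, 1)],
   [(20, 1), (21, 1), (12, 6)],
   [(22, 1), (21, 1), (22, 2)],
   [(22, 1), (20, 2), (23, 1)],
   [(24, 1), (23, 4), (23, 1)],
   [(24, 1), (25, 1), (22, 2)],
   [(19, 4), (25, 1), (26, 1)],
   [(27, 2), (27, 1), (26, 1)],
   [(28, 1), (27, 1), (25, 2)],
   [(28, 1), (29, 1), (27, 6)],
   [(27, 2), (29, 1), (30, 1)],
   [(31, 1), (31, 2), (30, 1)],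
   [(31, 1), (32, 1), (31, 3)],
   [(33, 1), (32, 1), (28, 3)],
   [(33, 1), (31, 2), (34, 1)],
   [(34, 3), (35, 1), (34, 1)],
   [(32, 3), (35, 1), (36, 1)],
   [(37, 1), (34, 2), (36, 1)],
   [(37, 1), (38, 1), (38, 2)],
   [(29, 6), (38, 1), (39, 1)],
   [(35, 3), (40, 1), (39, 1)],
   [(0, 0), (40, 1), (38, 2)]]

/-- The table entry for position `i` and letter `x`. -/
def entry (i : ℕ) (x : Fin 3) : ℕ × ℕ := (squareTable.getD i []).getD x.val (0, 0)

theorem table_ok : ∀ i < 42, ∀ x : Fin 3, ((i = 0 ∧ x = c) ∨ (i = 41 ∧ x = a)) ∨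
    squareAt (N.take i ++ x :: N.drop i) (entry i x).1 (entry i x).2 = true := by
  decide +kernel

theorem chk_cN : chk (c :: N) = true := by decide +kernel

theorem chk_Na : chk (N ++ [a]) = true := by decide +kernel

theorem squareFree_ext (i : ℕ) (hi : i < 42) (x : Fin 3) :
    SquareFree (N.take i ++ x :: N.drop i) ↔ (i = 0 ∧ x = c) ∨ (i = 41 ∧ x = a) := by
  constructor
  · intro h
    rcases table_ok i hi x with h1 | h1
    · exact h1
    · exact absurd h (not_squareFree_of_squareAt _ _ _ h1)
  · rintro (⟨rfl, rfl⟩ | ⟨rfl, rfl⟩)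
    · exact (chk_iff _).mp chk_cN
    · exact (chk_iff _).mp chk_Na

/-- The word `N` is square-free, and it has exactly two square-free
extensions, namely `cN` and `Na`: inserting a letter `x` between a prefix
`w'` and the corresponding suffix `w''` of `N` yields a square-free word
if and only if `w' = []` and `x = c`, or `w'' = []` and `x = a`. -/
theorem N_nearly_extremal :
    SquareFree N ∧ ∀ (w' w'' : List (Fin 3)) (x : Fin 3), N = w' ++ w'' →
      (SquareFree (w' ++ x :: w'') ↔
        (w' = [] ∧ x = c) ∨ (w'' = [] ∧ x = a)) := by
  refine ⟨(chk_iff N).mp chk_N, ?_⟩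
  intro w' w'' x h
  have hlen : w'.length + w''.length = 41 := by
    rw [← List.length_append, ← h]; rfl
  have key := squareFree_ext w'.length (by omega) x
  have h1 : N.take w'.length = w' := by rw [h]; simp
  have h2 : N.drop w'.length = w'' := by rw [h]; simp
  rw [h1, h2] at key
  rw [key, ← List.length_eq_zero_iff, ← List.length_eq_zero_iff (l := w'')]
  have : w'.length = 41 ↔ w''.length = 0 := by omega
  rw [this]
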